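/- For all n ≥ 1, the number of permutations of {1,...,n} avoiding the patterns 132, 2341, 3241, and 1234 equals 1 - (8/5)F_{n+1} + ((n+1)/5)(F_{n+3} + F_{n+1}), where F_k is the k-th Fibonacci number. -/

import Mathlib

/-- A function `π : Fin n → Fin n` contains the pattern `p : Fin k → ℕ` if there is a
strictly increasing choice of indices whose images under `π` have the same pairwise
order relations as the entries of `p`. -/
def Contains {n k : ℕ} (π : Fin n → Fin n) (p : Fin k → ℕ) : Prop :=
  ∃ f : Fin k → Fin n, StrictMono f ∧ ∀ i j, p i < p j ↔ π (f i) < π (f j)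

/-- `π` avoids the pattern `p`. -/
def Avoids {n k : ℕ} (π : Fin n → Fin n) (p : Fin k → ℕ) : Prop := ¬ Contains π p

/-- The set of permutations of `Fin n` avoiding the patterns 132, 2341 and 3241,
i.e. the 132-avoiding two-stack sortable permutations. -/
def TSS132 (n : ℕ) : Set (Fin n → Fin n) :=
  {π | Function.Bijective π ∧ Avoids π ![1,3,2] ∧ Avoids π ![2,3,4,1] ∧ Avoids π ![3,2,4,1]}

/-- The Pell numbers. -/
def pell : ℕ → ℕ
  | 0 => 0
  | 1 => 1
  | n+2 => 2 * pell (n+1) + pell n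

/-- `π` has no occurrence of `132`. -/
def No132 {n : ℕ} (π : Fin n → Fin n) : Prop :=
  ∀ i j k, i < j → j < k → ¬ (π i < π k ∧ π k < π j)

/-- `π` has no occurrence of `2341` and none of `3241` (for injective `π`). -/
def NoTwoStack {n : ℕ} (π : Fin n → Fin n) : Prop :=
  ∀ i j k l, i < j → j < k → k < l → ¬ (π l < π i ∧ π l < π j ∧ π i < π k ∧ π j < π k)

/-- `π` has no increasing subsequence of length two. -/
def No12 (n : ℕ) (π : Fin n → Fin n) : Prop := ∀ i j, i < j → ¬ π i < π j

/-- `π` has no increasing subsequence of length three. -/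
def No123 (n : ℕ) (π : Fin n → Fin n) : Prop :=
  ∀ i j k, i < j → j < k → ¬ (π i < π j ∧ π j < π k)

/-- `π` has no increasing subsequence of length four. -/
def No1234 (n : ℕ) (π : Fin n → Fin n) : Prop :=
  ∀ i j k l, i < j → j < k → k < l → ¬ (π i < π j ∧ π j < π k ∧ π k < π l)

/-- The permutations in `TSS132 n` with the additional property `Q`. -/
def classOf (Q : ∀ n, (Fin n → Fin n) → Prop) (n : ℕ) : Set (Fin n → Fin n) :=
  {π | Function.Injective π ∧ No132 π ∧ NoTwoStack π ∧ Q n π}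

theorem avoids_132_iff {n : ℕ} (π : Fin n → Fin n) :
    Avoids π ![1,3,2] ↔ No132 π := by
  unfold Avoids Contains No132
  constructor
  · intro h i j k hij hjk hc
    refine h ⟨![i, j, k], ?_, ?_⟩
    · simp [Fin.strictMono_iff_lt_succ, Fin.forall_fin_succ, hij, hjk]
    · simp [Fin.forall_fin_succ]
      omega
  · rintro h ⟨f, hf, hp⟩
    refine h (f 0) (f 1) (f 2) (hf (by decide)) (hf (by decide)) ⟨?_, ?_⟩ <;>
      exact (hp _ _).1 (by decide)

theorem avoids_1234_iff {n : ℕ} (π : Fin n → Fin n) :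
    Avoids π ![1,2,3,4] ↔ No1234 n π := by
  unfold Avoids Contains No1234
  constructor
  · intro h i j k l hij hjk hkl hc
    refine h ⟨![i, j, k, l], ?_, ?_⟩
    · simp [Fin.strictMono_iff_lt_succ, Fin.forall_fin_succ, hij, hjk, hkl]
    · simp [Fin.forall_fin_succ]
      omega
  · rintro h ⟨f, hf, hp⟩
    refine h (f 0) (f 1) (f 2) (f 3) (hf (by decide)) (hf (by decide)) (hf (by decide))
      ⟨?_, ?_, ?_⟩ <;> exact (hp _ _).1 (by decide)

theorem avoids_2341_and_3241_iff {n : ℕ} {π : Fin n → Fin n} (hπ : Function.Injective π) :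
    (Avoids π ![2,3,4,1] ∧ Avoids π ![3,2,4,1]) ↔ NoTwoStack π := by
  unfold Avoids Contains NoTwoStack
  constructor
  · rintro ⟨h, h'⟩ i j k l hij hjk hkl hc
    rcases lt_or_gt_of_ne (hπ.ne hij.ne) with hlt | hlt
    · refine h ⟨![i, j, k, l], ?_, ?_⟩
      · simp [Fin.strictMono_iff_lt_succ, Fin.forall_fin_succ, hij, hjk, hkl]
      · simp [Fin.forall_fin_succ]
        omega
    · refine h' ⟨![i, j, k, l], ?_, ?_⟩
      · simp [Fin.strictMono_iff_lt_succ, Fin.forall_fin_succ, hij, hjk, hkl]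
      · simp [Fin.forall_fin_succ]
        omega
  · intro h
    constructor <;> rintro ⟨f, hf, hp⟩ <;>
      refine h (f 0) (f 1) (f 2) (f 3) (hf (by decide)) (hf (by decide)) (hf (by decide))
        ⟨?_, ?_, ?_, ?_⟩ <;> exact (hp _ _).1 (by decide)

theorem TSS132_inter_avoids_1234 (n : ℕ) :
    {π ∈ TSS132 n | Avoids π ![1,2,3,4]} = classOf No1234 n := by
  ext π
  simp only [TSS132, classOf, Set.mem_ofPred_eq, avoids_132_iff, avoids_1234_iff,
    ← Finite.injective_iff_bijective]
  constructor
  · rintro ⟨⟨hi, h, h'⟩, hq⟩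
    exact ⟨hi, h, (avoids_2341_and_3241_iff hi).1 h', hq⟩
  · rintro ⟨hi, h, h', hq⟩
    exact ⟨⟨hi, h, (avoids_2341_and_3241_iff hi).2 h'⟩, hq⟩

/-- Append a new maximum on the right. -/
def snocMax {n : ℕ} (π : Fin n → Fin n) : Fin (n + 1) → Fin (n + 1) :=
  Fin.snoc (α := fun _ => Fin (n + 1)) (fun i => (π i).castSucc) (Fin.last n)

/-- Prepend a new maximum on the left. -/
def consMax {n : ℕ} (π : Fin n → Fin n) : Fin (n + 1) → Fin (n + 1) :=
  Fin.cons (α := fun _ => Fin (n + 1)) (Fin.last n) (fun i => (π i).castSucc)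

/-- Prepend the two new largest values, in increasing order. -/
def consTwoMax {n : ℕ} (π : Fin n → Fin n) : Fin (n + 2) → Fin (n + 2) :=
  Fin.cons (α := fun _ => Fin (n + 2)) (Fin.last n).castSucc
    (Fin.cons (α := fun _ => Fin (n + 2)) (Fin.last (n + 1)) (fun i => (π i).castSucc.castSucc))

@[simp] theorem snocMax_castSucc {n : ℕ} (π : Fin n → Fin n) (i : Fin n) :
    snocMax π i.castSucc = (π i).castSucc := by simp [snocMax]

@[simp] theorem snocMax_last {n : ℕ} (π : Fin n → Fin n) :
    snocMax π (Fin.last n) = Fin.last n := by simp [snocMax]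

@[simp] theorem consMax_zero {n : ℕ} (π : Fin n → Fin n) :
    consMax π 0 = Fin.last n := rfl

@[simp] theorem consMax_succ {n : ℕ} (π : Fin n → Fin n) (i : Fin n) :
    consMax π i.succ = (π i).castSucc := rfl

@[simp] theorem consTwoMax_zero {n : ℕ} (π : Fin n → Fin n) :
    consTwoMax π 0 = (Fin.last n).castSucc := rfl

@[simp] theorem consTwoMax_one {n : ℕ} (π : Fin n → Fin n) :
    consTwoMax π 1 = Fin.last (n + 1) := rfl

@[simp] theorem consTwoMax_succ_succ {n : ℕ} (π : Fin n → Fin n) (i : Fin n) :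
    consTwoMax π i.succ.succ = (π i).castSucc.castSucc := rfl

theorem snocMax_injective {n : ℕ} : Function.Injective (snocMax (n := n)) := fun π σ h =>
  funext fun i => Fin.castSucc_injective _ (by simpa using congrFun h i.castSucc)

theorem consMax_injective {n : ℕ} : Function.Injective (consMax (n := n)) := fun π σ h =>
  funext fun i => Fin.castSucc_injective _ (by simpa using congrFun h i.succ)

theorem consTwoMax_injective {n : ℕ} : Function.Injective (consTwoMax (n := n)) := fun π σ h =>
  funext fun i => Fin.castSucc_injective _ <| Fin.castSucc_injective _
    (by simpa using congrFun h i.succ.succ)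

theorem castSucc_castSucc_lt {n : ℕ} (i : Fin n) :
    i.castSucc.castSucc < (Fin.last n).castSucc := by
  rw [Fin.lt_def]; simp

theorem castSucc_castSucc_lt_last {n : ℕ} (i : Fin n) :
    i.castSucc.castSucc < Fin.last (n + 1) := by
  rw [Fin.lt_def]; simp

section insertion
variable {n : ℕ} (π : Fin n → Fin n)

theorem snocMax_inj : Function.Injective (snocMax π) ↔ Function.Injective π := by
  simp [Function.Injective, Fin.forall_fin_succ', Fin.castSucc_ne_last,
    fun i : Fin n => (Fin.castSucc_ne_last i).symm]

theorem no132_snocMax : No132 (snocMax π) ↔ No132 π := by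
  simp [No132, Fin.forall_fin_succ', Fin.le_last]

theorem noTwoStack_snocMax : NoTwoStack (snocMax π) ↔ NoTwoStack π := by
  simp [NoTwoStack, Fin.forall_fin_succ', Fin.le_last]

theorem no123_snocMax : No123 _ (snocMax π) ↔ No12 _ π := by
  simp [No123, No12, Fin.forall_fin_succ', Fin.le_last]
  grind

theorem no1234_snocMax : No1234 _ (snocMax π) ↔ No123 _ π := by
  simp [No1234, No123, Fin.forall_fin_succ', Fin.le_last]
  grind

theorem consMax_inj : Function.Injective (consMax π) ↔ Function.Injective π := by
  simp [Function.Injective, Fin.forall_fin_succ, Fin.castSucc_ne_last,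
    fun i : Fin n => (Fin.castSucc_ne_last i).symm]

theorem no132_consMax : No132 (consMax π) ↔ No132 π := by
  simp [No132, Fin.forall_fin_succ, Fin.le_last]

theorem noTwoStack_consMax : NoTwoStack (consMax π) ↔ NoTwoStack π := by
  simp [NoTwoStack, Fin.forall_fin_succ, Fin.le_last]

theorem no123_consMax : No123 _ (consMax π) ↔ No123 _ π := by
  simp [No123, Fin.forall_fin_succ, Fin.le_last]

theorem no1234_consMax : No1234 _ (consMax π) ↔ No1234 _ π := by
  simp [No1234, Fin.forall_fin_succ, Fin.le_last]

theorem consTwoMax_inj : Function.Injective (consTwoMax π) ↔ Function.Injective π := by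
  have h1 (i : Fin n) := (castSucc_castSucc_lt i).ne
  have h2 (i : Fin n) := (castSucc_castSucc_lt_last i).ne
  simp [Function.Injective, Fin.forall_fin_succ, h1, h2, fun i => (h1 i).symm,
    fun i => (h2 i).symm, Fin.castSucc_ne_last, (Fin.castSucc_ne_last (Fin.last n)).symm]

theorem no132_consTwoMax : No132 (consTwoMax π) ↔ No132 π := by
  simp [No132, Fin.forall_fin_succ, Fin.le_last]

theorem noTwoStack_consTwoMax : NoTwoStack (consTwoMax π) ↔ NoTwoStack π := by
  simp [NoTwoStack, Fin.forall_fin_succ, Fin.le_last]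

theorem no123_consTwoMax : No123 _ (consTwoMax π) ↔ No123 _ π := by
  simp [No123, Fin.forall_fin_succ, Fin.le_last]

theorem no1234_consTwoMax : No1234 _ (consTwoMax π) ↔ No1234 _ π := by
  simp [No1234, Fin.forall_fin_succ, Fin.le_last]

end insertion

theorem exists_eq_snocMax {n : ℕ} {π : Fin (n + 1) → Fin (n + 1)} (hπ : Function.Injective π)
    (h : π (Fin.last n) = Fin.last n) : ∃ σ, snocMax σ = π := by
  have hne (i : Fin n) : π i.castSucc ≠ Fin.last n := fun hi =>
    (Fin.castSucc_ne_last i) (hπ (hi.trans h.symm))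
  refine ⟨fun i => (π i.castSucc).castPred (hne i), funext fun i => ?_⟩
  induction i using Fin.lastCases <;> simp [h]

theorem exists_eq_consMax {n : ℕ} {π : Fin (n + 1) → Fin (n + 1)} (hπ : Function.Injective π)
    (h : π 0 = Fin.last n) : ∃ σ, consMax σ = π := by
  have hne (i : Fin n) : π i.succ ≠ Fin.last n := fun hi =>
    (Fin.succ_ne_zero i) (hπ (hi.trans h.symm))
  refine ⟨fun i => (π i.succ).castPred (hne i), funext fun i => ?_⟩
  induction i using Fin.cases <;> simp [h]

theorem exists_eq_consTwoMax {n : ℕ} {π : Fin (n + 2) → Fin (n + 2)}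
    (hπ : Function.Injective π) (h0 : π 0 = (Fin.last n).castSucc)
    (h1 : π 1 = Fin.last (n + 1)) : ∃ σ, consTwoMax σ = π := by
  have hlt (i : Fin n) : (π i.succ.succ : ℕ) < n := by
    have a : π i.succ.succ ≠ π 0 := hπ.ne (by simp [Fin.ext_iff])
    have b : π i.succ.succ ≠ π 1 := hπ.ne (by simp [Fin.ext_iff])
    rw [h0, Fin.ne_iff_vne] at a
    rw [h1, Fin.ne_iff_vne] at b
    simp at a b
    omega
  refine ⟨fun i => ⟨π i.succ.succ, hlt i⟩, funext fun i => ?_⟩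
  induction i using Fin.cases with
  | zero => simp [h0]
  | succ i =>
    induction i using Fin.cases with
    | zero => simp [h1]
    | succ i => ext; simp

/-- The maximum of a permutation in the class is in one of the first two positions or the last. -/
theorem exists_eq_of_no132 {n : ℕ} {π : Fin (n + 2) → Fin (n + 2)}
    (hπ : Function.Injective π) (h : No132 π) (h' : NoTwoStack π) :
    (∃ σ, snocMax σ = π) ∨ (∃ σ, consMax σ = π) ∨ ∃ σ, consTwoMax σ = π := by
  have hsurj := Finite.injective_iff_surjective.1 hπ
  obtain ⟨m, hm⟩ := hsurj (Fin.last (n + 1))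
  have hlt (i) (hi : i ≠ m) : π i < π m := by
    rw [hm]; exact Fin.lt_last_iff_ne_last.2 (fun e => hi (hπ (e.trans hm.symm)))
  have hlt' (i k) (hi : i < m) (hk : m < k) : π k < π i :=
    lt_of_le_of_ne (not_lt.1 fun hc => h i m k hi hk ⟨hc, hlt k hk.ne'⟩)
      (hπ.ne (hi.trans hk).ne')
  by_cases hl : m = Fin.last (n + 1)
  · exact .inl (exists_eq_snocMax hπ (hl ▸ hm))
  by_cases h0 : m = 0
  · exact .inr (.inl (exists_eq_consMax hπ (h0 ▸ hm)))
  have hml : m < Fin.last (n + 1) := Fin.lt_last_iff_ne_last.2 hl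
  have h0m : 0 < m := Fin.pos_of_ne_zero h0
  by_cases h1 : m = 1
  · refine .inr (.inr (exists_eq_consTwoMax hπ ?_ (h1 ▸ hm)))
    obtain ⟨j, hj⟩ := hsurj (Fin.last n).castSucc
    suffices j = 0 by rw [← this, hj]
    by_contra hj0
    have hjm : j ≠ m := by
      rintro rfl
      exact Fin.castSucc_ne_last _ (hj.symm.trans hm)
    have hmj : m < j := by
      have hj0' : (j : ℕ) ≠ 0 := Fin.val_ne_of_ne hj0
      have hjm' : (j : ℕ) ≠ m := Fin.val_ne_of_ne hjm
      have hm1 : (m : ℕ) = 1 := by rw [h1, Fin.val_one]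
      rw [Fin.lt_def]
      omega
    have hlt0 := hlt' 0 j h0m hmj
    have := hlt 0 h0m.ne
    rw [hj] at hlt0
    rw [hm] at this
    simp [Fin.lt_def] at this hlt0
    omega
  · have h1m : 1 < m := by
      have hm0 : (m : ℕ) ≠ 0 := Fin.val_ne_of_ne h0
      have hm1 : (m : ℕ) ≠ 1 := fun e => h1 (Fin.ext (by rw [e, Fin.val_one]))
      rw [Fin.lt_def, Fin.val_one]
      omega
    exact (h' 0 1 m (Fin.last (n + 1)) (by simp) h1m hml
      ⟨hlt' _ _ h0m hml, hlt' _ _ h1m hml, hlt _ h0m.ne, hlt _ h1m.ne⟩).elim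

theorem ncard_classOf_add_three (Q Q' : ∀ n, (Fin n → Fin n) → Prop)
    (hs : ∀ n (π : Fin n → Fin n), Q' _ (snocMax π) ↔ Q _ π)
    (hc : ∀ n (π : Fin n → Fin n), Q' _ (consMax π) ↔ Q' _ π)
    (hct : ∀ n (π : Fin n → Fin n), Q' _ (consTwoMax π) ↔ Q' _ π) (n : ℕ) :
    (classOf Q' (n + 3)).ncard =
      (classOf Q (n + 2)).ncard + (classOf Q' (n + 2)).ncard + (classOf Q' (n + 1)).ncard := by
  have hmems (π : Fin (n + 2) → Fin (n + 2)) :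
      snocMax π ∈ classOf Q' (n + 3) ↔ π ∈ classOf Q (n + 2) := by
    simp only [classOf, Set.mem_ofPred_eq, snocMax_inj, no132_snocMax, noTwoStack_snocMax, hs]
  have hmemc (π : Fin (n + 2) → Fin (n + 2)) :
      consMax π ∈ classOf Q' (n + 3) ↔ π ∈ classOf Q' (n + 2) := by
    simp only [classOf, Set.mem_ofPred_eq, consMax_inj, no132_consMax, noTwoStack_consMax, hc]
  have hmemct (π : Fin (n + 1) → Fin (n + 1)) :
      consTwoMax π ∈ classOf Q' (n + 3) ↔ π ∈ classOf Q' (n + 1) := by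
    simp only [classOf, Set.mem_ofPred_eq, consTwoMax_inj, no132_consTwoMax,
      noTwoStack_consTwoMax, hct]
  have key : classOf Q' (n + 3) = snocMax '' classOf Q (n + 2) ∪ consMax '' classOf Q' (n + 2) ∪
      consTwoMax '' classOf Q' (n + 1) := by
    ext π
    simp only [Set.mem_union, Set.mem_image]
    constructor
    · intro h
      rcases exists_eq_of_no132 h.1 h.2.1 h.2.2.1 with ⟨σ, rfl⟩ | ⟨σ, rfl⟩ | ⟨σ, rfl⟩
      · exact .inl (.inl ⟨σ, (hmems σ).1 h, rfl⟩)
      · exact .inl (.inr ⟨σ, (hmemc σ).1 h, rfl⟩)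
      · exact .inr ⟨σ, (hmemct σ).1 h, rfl⟩
    · rintro ((⟨σ, h, rfl⟩ | ⟨σ, h, rfl⟩) | ⟨σ, h, rfl⟩)
      exacts [(hmems σ).2 h, (hmemc σ).2 h, (hmemct σ).2 h]
  have hlast (σ : Fin (n + 2) → Fin (n + 2)) (τ : Fin (n + 2) → Fin (n + 2)) :
      snocMax σ ≠ consMax τ := fun h => by
    have := congrFun h (Fin.last (n + 1)).succ
    rw [consMax_succ, Fin.succ_last, snocMax_last] at this
    exact Fin.castSucc_ne_last _ this.symm
  have hlast' (σ : Fin (n + 2) → Fin (n + 2)) (τ : Fin (n + 1) → Fin (n + 1)) :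
      snocMax σ ≠ consTwoMax τ := fun h => by
    have := congrFun h (Fin.last n).succ.succ
    rw [consTwoMax_succ_succ, Fin.succ_last, Fin.succ_last, snocMax_last] at this
    exact Fin.castSucc_ne_last _ this.symm
  have hfirst (σ : Fin (n + 2) → Fin (n + 2)) (τ : Fin (n + 1) → Fin (n + 1)) :
      consMax σ ≠ consTwoMax τ := fun h => by
    have := congrFun h 0
    rw [consMax_zero, consTwoMax_zero] at this
    exact Fin.castSucc_ne_last _ this.symm
  rw [key, Set.ncard_union_eq, Set.ncard_union_eq, Set.ncard_image_of_injective _ snocMax_injective,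
    Set.ncard_image_of_injective _ consMax_injective,
    Set.ncard_image_of_injective _ consTwoMax_injective]
  · rw [Set.disjoint_left]
    rintro _ ⟨σ, -, rfl⟩ ⟨τ, -, h⟩
    exact hlast _ _ h.symm
  · rw [Set.disjoint_left]
    rintro _ (⟨σ, -, rfl⟩ | ⟨σ, -, rfl⟩) ⟨τ, -, h⟩
    exacts [hlast' _ _ h.symm, hfirst _ _ h.symm]

theorem ncard_classOf_no12 (n : ℕ) : (classOf No12 n).ncard = 1 := by
  refine Set.ncard_eq_one.2 ⟨Fin.rev, Set.ext fun π => ?_⟩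
  simp only [Set.mem_singleton_iff]
  constructor
  · rintro ⟨hi, -, -, h⟩
    have hm : StrictMono (Fin.rev ∘ π) := fun i j hij =>
      Fin.rev_lt_rev.2 (lt_of_le_of_ne (not_lt.1 (h i j hij)) (hi.ne hij.ne'))
    exact funext fun i => by simpa using congrArg Fin.rev (congrFun hm.eq_id i)
  · rintro rfl
    refine ⟨Fin.rev_injective, ?_, ?_, ?_⟩
    · intro i j k hij hjk
      simp only [Fin.rev_lt_rev]
      omega
    · intro i j k l hij hjk hkl
      simp only [Fin.rev_lt_rev]
      omega
    · intro i j hij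
      simp only [Fin.rev_lt_rev]
      omega

theorem ncard_classOf_of_le_two {Q : ∀ n, (Fin n → Fin n) → Prop} {n : ℕ} (hn : n ≤ 2)
    (hQ : ∀ π, Q n π) : (classOf Q n).ncard = n.factorial := by
  have h (π : Fin n → Fin n) : No132 π := fun i j k hij hjk => by omega
  have h' (π : Fin n → Fin n) : NoTwoStack π := fun i j k l hij hjk hkl => by omega
  have key : classOf Q n = {π | Function.Injective π} := by
    ext π
    simp [classOf, h, h', hQ]
  rw [key, ← Nat.card_coe_set_eq]
  refine (Nat.card_congr (Equiv.subtypeInjectiveEquivEmbedding (Fin n) (Fin n))).trans ?_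
  simp [Fintype.card_embedding_eq, Nat.descFactorial_self]

theorem ncard_classOf_no123 (n : ℕ) :
    (classOf No123 (n + 1)).ncard + 1 = Nat.fib (n + 3) := by
  induction n using Nat.twoStepInduction with
  | zero => rw [ncard_classOf_of_le_two (by omega) fun π i j k hij hjk => by omega]; rfl
  | one => rw [ncard_classOf_of_le_two (by omega) fun π i j k hij hjk => by omega]; rfl
  | more n ih ih' =>
    rw [ncard_classOf_add_three No12 No123 (fun _ => no123_snocMax) (fun _ => no123_consMax)
      (fun _ => no123_consTwoMax), ncard_classOf_no12, Nat.fib_add_two (n := n + 3), ← ih, ← ih']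
    ring

theorem ncard_classOf_no1234 (n : ℕ) :
    ((classOf No1234 (n + 1)).ncard : ℚ) = 1 - 8 / 5 * Nat.fib (n + 2) +
      (n + 2) / 5 * (Nat.fib (n + 4) + Nat.fib (n + 2)) := by
  induction n using Nat.twoStepInduction with
  | zero =>
    have : (classOf No1234 1).ncard = 1 :=
      ncard_classOf_of_le_two (by omega) fun π i j k l hij hjk hkl => by omega
    norm_num [this, Nat.fib_add_two]
  | one =>
    have : (classOf No1234 2).ncard = 2 :=
      ncard_classOf_of_le_two (by omega) fun π i j k l hij hjk hkl => by omega
    norm_num [this, Nat.fib_add_two]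
  | more n ih ih' =>
    have h := congrArg (Nat.cast (R := ℚ)) (ncard_classOf_no123 (n + 1))
    push_cast at h
    rw [ncard_classOf_add_three No123 No1234 (fun _ => no1234_snocMax) (fun _ => no1234_consMax)
      (fun _ => no1234_consTwoMax)]
    push_cast
    rw [ih, ih', eq_sub_of_add_eq h]
    simp only [Nat.fib_add_two, Nat.cast_add]
    push_cast
    ring

theorem stmt_7 (n : ℕ) (hn : 1 ≤ n) :
    (Nat.card ↥{π ∈ TSS132 n | Avoids π ![1,2,3,4]} : ℚ) =
      1 - 8/5 * Nat.fib (n+1) + (n+1)/5 * (Nat.fib (n+3) + Nat.fib (n+1)) := by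
  obtain ⟨n, rfl⟩ := Nat.exists_eq_add_of_le' hn
  rw [TSS132_inter_avoids_1234, Nat.card_coe_set_eq, ncard_classOf_no1234]
  push_cast
  ring
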